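/- arXiv:2508.21534 — 2 statements merged into one kernel-verified Lean document; each statement's English description precedes it below -/
import Mathlib

section
/- Let p, n ≥ 1, let S = (S_0, …, S_{2n}) be a truncated matrix moment sequence whose moment matrix M(n) is positive definite, let t ∈ ℝ and m ∈ ℕ ∪ {0}. Then the following are equivalent: (1) there exist a minimal representing measure for S (pairwise distinct x_1,…,x_ℓ ∈ ℝ and nonzero PSD symmetric p×p matrices A_1,…,A_ℓ with S_i = Σ_j x_j^i A_j for 0 ≤ i ≤ 2n and Σ_j rank A_j = (n+1)p) whose multiplicity at t equals m; (2) m ≤ rank H_{x−t}(n−1) − (n−1)p, where H_{x−t}(n−1) is the (x−t)-localizing moment matrix of S. -/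
open Matrix

/-- The `n`-th truncated moment matrix of a sequence of `p × p` real matrices:
the `(i,j)`-th `p × p` block is `S (i + j)` for `0 ≤ i, j ≤ n`. -/
def momentMatrix (p n : ℕ) (S : ℕ → Matrix (Fin p) (Fin p) ℝ) :
    Matrix (Fin (n + 1) × Fin p) (Fin (n + 1) × Fin p) ℝ :=
  fun i j => S (i.1.1 + j.1.1) i.2 j.2

/-- The `(x - t)`-localizing moment matrix `H_{x-t}(n-1)` of size `np`:
the `(i,j)`-th `p × p` block is `S (i + j + 1) - t • S (i + j)` for `0 ≤ i, j ≤ n - 1`. -/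
def locMatrix (p n : ℕ) (t : ℝ) (S : ℕ → Matrix (Fin p) (Fin p) ℝ) :
    Matrix (Fin n × Fin p) (Fin n × Fin p) ℝ :=
  fun i j => S (i.1.1 + j.1.1 + 1) i.2 j.2 - t * S (i.1.1 + j.1.1) i.2 j.2

/-- A minimal representing measure for the truncated matrix moment sequence
`S_0, …, S_{2n}`: pairwise distinct atoms `x j`, nonzero PSD masses `A j` with
`S i = ∑ j (x j)^i • A j` for `i ≤ 2n` and total rank `(n+1)p`. -/
def IsMinimalRepMeasure (p n ℓ : ℕ) (S : ℕ → Matrix (Fin p) (Fin p) ℝ)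
    (x : Fin ℓ → ℝ) (A : Fin ℓ → Matrix (Fin p) (Fin p) ℝ) : Prop :=
  Function.Injective x ∧
    (∀ j, A j ≠ 0 ∧ (A j).PosSemidef) ∧
    (∀ i ≤ 2 * n, S i = ∑ j, x j ^ i • A j) ∧
    (∑ j, (A j).rank) = (n + 1) * p

/-- The multiplicity of `t` in the measure given by atoms `x` and masses `A` equals `m`. -/
def MultiplicityEq {p : ℕ} (ℓ : ℕ) (x : Fin ℓ → ℝ)
    (A : Fin ℓ → Matrix (Fin p) (Fin p) ℝ) (t : ℝ) (m : ℕ) : Prop :=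
  (∃ j, x j = t ∧ (A j).rank = m) ∨ ((∀ j, x j ≠ t) ∧ m = 0)

theorem ext_sym_aux {V : Type*} [NormedAddCommGroup V] [InnerProductSpace ℝ V]
    [FiniteDimensional ℝ V] (d : ℕ) : ∀ (W : Submodule ℝ V) (K : V →ₗ[ℝ] V),
    Module.finrank ℝ Wᗮ = d →
    (∀ w ∈ W, ∀ w' ∈ W, inner ℝ (K w) w' = inner ℝ w (K w')) →
    ∃ K' : V →ₗ[ℝ] V, (∀ w ∈ W, K' w = K w) ∧ K'.IsSymmetric ∧
      ∀ v, K' v = 0 → v ∈ W := by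
  induction d with
  | zero =>
    intro W K hd hK
    have hW : W = ⊤ := by
      rw [Submodule.finrank_eq_zero] at hd
      exact (Submodule.orthogonal_eq_bot_iff).1 hd
    subst hW
    exact ⟨K, fun _ _ => rfl, fun x y => hK x trivial y trivial, fun _ _ => trivial⟩
  | succ d ih =>
    intro W K hd hK
    have hne : Wᗮ ≠ ⊥ := by
      intro h
      rw [h] at hd
      simp at hd
    obtain ⟨u, hu, hu0⟩ := Submodule.exists_mem_ne_zero_of_ne_bot hne
    have huu : inner ℝ u u ≠ 0 := by simpa using hu0
    have huW : ∀ w ∈ W, inner ℝ u w = 0 := fun w hw => Submodule.inner_left_of_mem_orthogonal hw hu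
    have huW' : ∀ w ∈ W, inner ℝ w u = 0 := fun w hw => Submodule.inner_right_of_mem_orthogonal hw hu
    -- choose v
    obtain ⟨v, hv1, hv2⟩ : ∃ v : V, (∀ w ∈ W, inner ℝ v w = inner ℝ u (K w)) ∧
        ∀ w ∈ W, K w ≠ v := by
      have h0 : ∀ w, inner ℝ (LinearMap.adjoint K u) w = inner ℝ u (K w) :=
        fun w => LinearMap.adjoint_inner_left K w u
      by_cases h : ∃ w0 ∈ W, K w0 = LinearMap.adjoint K u
      · obtain ⟨w0, hw0, hw0'⟩ := h
        refine ⟨LinearMap.adjoint K u + u, fun w hw => ?_, fun w hw hc => ?_⟩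
        · rw [inner_add_left, h0, huW w hw, add_zero]
        · have hz : K (w - w0) = u := by rw [map_sub, hc, hw0']; abel
          have hzW : w - w0 ∈ W := W.sub_mem hw hw0
          have h1 := h0 (w - w0)
          rw [hz, ← hw0', hK w0 hw0 _ hzW, hz, huW' _ hw0] at h1
          exact huu h1.symm
      · refine ⟨LinearMap.adjoint K u, fun w hw => h0 w, fun w hw hc => h ⟨w, hw, hc⟩⟩
    let K1 : V →ₗ[ℝ] V := K + ((inner ℝ u u)⁻¹ • (innerₛₗ ℝ u)).smulRight (v - K u)
    have hK1W : ∀ w ∈ W, K1 w = K w := by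
      intro w hw
      simp [K1, huW w hw]
    have hK1u : K1 u = v := by
      simp only [K1, LinearMap.add_apply, LinearMap.smulRight_apply, LinearMap.smul_apply,
        innerₛₗ_apply_apply, smul_eq_mul]
      rw [inv_mul_cancel₀ huu, one_smul]; abel
    let W1 := W ⊔ Submodule.span ℝ {u}
    have hmem : ∀ x ∈ W1, ∃ w ∈ W, ∃ c : ℝ, x = w + c • u := by
      intro x hx
      obtain ⟨w, hw, y, hy, rfl⟩ := Submodule.mem_sup.1 hx
      obtain ⟨c, rfl⟩ := Submodule.mem_span_singleton.1 hy
      exact ⟨w, hw, c, rfl⟩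
    have hWW1 : W ≤ W1 := le_sup_left
    have huW1 : u ∈ W1 := (le_sup_right : _ ≤ W1) (Submodule.mem_span_singleton_self u)
    have hdim : Module.finrank ℝ W1ᗮ = d := by
      have h1 := W.finrank_add_finrank_orthogonal
      have h2 := W1.finrank_add_finrank_orthogonal
      have h3 := Submodule.finrank_sup_add_finrank_inf_eq W (Submodule.span ℝ {u})
      have h4 : W ⊓ Submodule.span ℝ {u} = ⊥ := by
        rw [eq_bot_iff]
        rintro x ⟨hx1, hx2⟩
        obtain ⟨c, rfl⟩ := Submodule.mem_span_singleton.1 hx2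
        have := huW _ hx1
        rw [inner_smul_right] at this
        have hc : c = 0 := by simpa [hu0] using this
        simp [hc]
      rw [h4, finrank_bot, finrank_span_singleton hu0] at h3
      change Module.finrank ℝ W1 + 0 = _ at h3
      omega
    have hsym1 : ∀ w ∈ W1, ∀ w' ∈ W1, inner ℝ (K1 w) w' = inner ℝ w (K1 w') := by
      intro x hx y hy
      obtain ⟨w, hw, c, rfl⟩ := hmem x hx
      obtain ⟨w', hw', c', rfl⟩ := hmem y hy
      simp only [map_add, map_smul, hK1u, hK1W w hw, hK1W w' hw', inner_add_left, inner_add_right,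
        inner_smul_left, inner_smul_right, hK w hw w' hw', hv1 w' hw', RCLike.conj_to_real]
      have e1 : inner ℝ (K w) u = inner ℝ w v := by
        rw [real_inner_comm, ← hv1 w hw, real_inner_comm]
      rw [e1, real_inner_comm u v]
    obtain ⟨K', h1, h2, h3⟩ := ih W1 K1 hdim hsym1
    refine ⟨K', fun w hw => (h1 w (hWW1 hw)).trans (hK1W w hw), h2, fun x hx => ?_⟩
    have hx1 := h3 x hx
    rw [h1 x hx1] at hx
    obtain ⟨w, hw, c, rfl⟩ := hmem x hx1
    rw [map_add, map_smul, hK1u, hK1W w hw] at hx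
    by_cases hc : c = 0
    · simpa [hc] using hw
    · exfalso
      apply hv2 (-(c⁻¹) • w) (W.smul_mem _ hw)
      have : K w = - (c • v) := eq_neg_of_add_eq_zero_left hx
      rw [map_smul, this, smul_neg, neg_smul, neg_neg, smul_smul, inv_mul_cancel₀ hc, one_smul]

theorem ext_sym_ker {V : Type*} [NormedAddCommGroup V] [InnerProductSpace ℝ V]
    [FiniteDimensional ℝ V] (W : Submodule ℝ V) (K : V →ₗ[ℝ] V)
    (hK : ∀ w ∈ W, ∀ w' ∈ W, inner ℝ (K w) w' = inner ℝ w (K w'))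
    (hinj : ∀ w ∈ W, K w = 0 → w = 0) (Z : Submodule ℝ V)
    (hZ : ∀ z ∈ W, (∀ w ∈ W, inner ℝ (K z) w = 0) → z ∈ Z) (m : ℕ)
    (hm : m + Module.finrank ℝ Z + Module.finrank ℝ W ≤ Module.finrank ℝ V) :
    ∃ K' : V →ₗ[ℝ] V, (∀ w ∈ W, K' w = K w) ∧ K'.IsSymmetric ∧
      Module.finrank ℝ (LinearMap.ker K') = m := by
  -- R = (K W)ᗮ
  let R : Submodule ℝ V := (W.map K)ᗮ
  have hR : ∀ r ∈ R, ∀ w ∈ W, inner ℝ (K w) r = 0 := fun r hr w hw =>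
    Submodule.inner_right_of_mem_orthogonal (Submodule.mem_map_of_mem hw) hr
  have hRdim : Module.finrank ℝ V ≤ Module.finrank ℝ R + Module.finrank ℝ W := by
    have h1 := (W.map K).finrank_add_finrank_orthogonal
    have h2 := Submodule.finrank_map_le K W
    change _ + Module.finrank ℝ R = _ at h1
    omega
  have hRW : R ⊓ W ≤ Z := by
    rintro z ⟨hz1, hz2⟩
    refine hZ z hz2 fun w hw => ?_
    rw [hK z hz2 w hw, real_inner_comm]
    exact hR z hz1 w hw
  have hRWdim := Submodule.finrank_mono hRW
  -- complement of R ⊓ W in R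
  obtain ⟨Q, hQ⟩ := (R ⊓ W).exists_isCompl
  have hQR : Module.finrank ℝ R ≤ Module.finrank ℝ (R ⊓ Q : Submodule ℝ V) +
      Module.finrank ℝ (R ⊓ W : Submodule ℝ V) := by
    have h1 := Submodule.finrank_sup_add_finrank_inf_eq (R ⊓ Q) (R ⊓ W)
    have h2 : R ≤ (R ⊓ Q) ⊔ (R ⊓ W) := by
      intro r hr
      have : r ∈ (R ⊓ W) ⊔ Q := by rw [hQ.sup_eq_top]; trivial
      obtain ⟨a, ha, b, hb, rfl⟩ := Submodule.mem_sup.1 this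
      have hb' : b ∈ R := by
        have := R.sub_mem hr ha.1
        simpa using this
      rw [add_comm]
      exact Submodule.add_mem_sup ⟨hb', hb⟩ ha
    have h3 := Submodule.finrank_mono h2
    omega
  have hmle : m ≤ Module.finrank ℝ (R ⊓ Q : Submodule ℝ V) := by omega
  obtain ⟨f, hf⟩ := exists_linearIndependent_of_le_finrank hmle
  have hf' : LinearIndependent ℝ (fun i => (f i : V)) :=
    hf.map' (R ⊓ Q : Submodule ℝ V).subtype (Submodule.ker_subtype _)
  let E : Submodule ℝ V := Submodule.span ℝ (Set.range fun i => (f i : V))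
  have hE : Module.finrank ℝ E = m := by
    simpa using finrank_span_eq_card hf'
  have hER : E ≤ R ⊓ Q := by
    rw [Submodule.span_le]
    rintro _ ⟨i, rfl⟩
    exact (f i).2
  have hdisj : Disjoint W E := by
    rw [Submodule.disjoint_def]
    intro x hxW hxE
    have h1 := hER hxE
    exact (Submodule.disjoint_def.1 hQ.disjoint) x ⟨h1.1, hxW⟩ h1.2
  obtain ⟨P, hWP, hP⟩ := hdisj.exists_isCompl
  let K1 : V →ₗ[ℝ] V := K ∘ₗ P.projection E hP
  have hK1W : ∀ w ∈ W, K1 w = K w := by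
    intro w hw
    simp only [K1, LinearMap.comp_apply]
    rw [Submodule.projection_apply_of_mem_left hP (hWP hw)]
  have hK1E : ∀ e ∈ E, K1 e = 0 := by
    intro e he
    simp only [K1, LinearMap.comp_apply]
    rw [(Submodule.projection_apply_eq_zero_iff hP).2 he, map_zero]
  have hsym : ∀ w ∈ W ⊔ E, ∀ w' ∈ W ⊔ E, inner ℝ (K1 w) w' = inner ℝ w (K1 w') := by
    intro x hx y hy
    obtain ⟨w, hw, e, he, rfl⟩ := Submodule.mem_sup.1 hx
    obtain ⟨w', hw', e', he', rfl⟩ := Submodule.mem_sup.1 hy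
    rw [map_add, map_add, hK1W w hw, hK1W w' hw', hK1E e he, hK1E e' he', add_zero, add_zero,
      inner_add_left, inner_add_right, hK w hw w' hw', hR e' (hER he').1 w hw,
      real_inner_comm (K w') e, hR e (hER he).1 w' hw']
  obtain ⟨K', h1, h2, h3⟩ := ext_sym_aux _ (W ⊔ E) K1 rfl hsym
  refine ⟨K', fun w hw => ?_, h2, ?_⟩
  · rw [h1 w (Submodule.mem_sup_left hw), hK1W w hw]
  · suffices h : LinearMap.ker K' = E by rw [h, hE]
    ext x
    rw [LinearMap.mem_ker]
    constructor
    · intro hx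
      have hx1 := h3 x hx
      rw [h1 x hx1] at hx
      obtain ⟨w, hw, e, he, rfl⟩ := Submodule.mem_sup.1 hx1
      rw [map_add, hK1W w hw, hK1E e he, add_zero] at hx
      rw [hinj w hw hx, zero_add]
      exact he
    · intro hx
      rw [h1 x (Submodule.mem_sup_right hx), hK1E x hx]

/-- extension by zero at the top degree. -/
def jZero (p n : ℕ) : (Fin n × Fin p → ℝ) →ₗ[ℝ] (Fin (n + 1) × Fin p → ℝ) where
  toFun c := fun q => Fin.snoc (α := fun _ => ℝ) (fun i => c (i, q.2)) 0 q.1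
  map_add' c d := by
    ext ⟨i, a⟩
    refine Fin.lastCases ?_ (fun i => ?_) i <;> simp
  map_smul' r c := by
    ext ⟨i, a⟩
    refine Fin.lastCases ?_ (fun i => ?_) i <;> simp

/-- multiplication by the variable. -/
def jOne (p n : ℕ) : (Fin n × Fin p → ℝ) →ₗ[ℝ] (Fin (n + 1) × Fin p → ℝ) where
  toFun c := fun q => Fin.cons (α := fun _ => ℝ) 0 (fun i => c (i, q.2)) q.1
  map_add' c d := by
    ext ⟨i, a⟩
    refine Fin.cases ?_ (fun i => ?_) i <;> simp
  map_smul' r c := by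
    ext ⟨i, a⟩
    refine Fin.cases ?_ (fun i => ?_) i <;> simp

/-- multiplication by `X - t`. -/
def kMul (p n : ℕ) (t : ℝ) : (Fin n × Fin p → ℝ) →ₗ[ℝ] (Fin (n + 1) × Fin p → ℝ) :=
  jOne p n - t • jZero p n

theorem jZero_castSucc (p n : ℕ) (c : Fin n × Fin p → ℝ) (i : Fin n) (a : Fin p) :
    jZero p n c (i.castSucc, a) = c (i, a) := by simp [jZero]

theorem jZero_last (p n : ℕ) (c : Fin n × Fin p → ℝ) (a : Fin p) :
    jZero p n c (Fin.last n, a) = 0 := by simp [jZero]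

theorem jOne_succ (p n : ℕ) (c : Fin n × Fin p → ℝ) (i : Fin n) (a : Fin p) :
    jOne p n c (i.succ, a) = c (i, a) := by simp [jOne]

theorem jOne_zero (p n : ℕ) (c : Fin n × Fin p → ℝ) (a : Fin p) :
    jOne p n c (0, a) = 0 := by simp [jOne]

theorem jZero_dot (p n : ℕ) (c : Fin n × Fin p → ℝ) (v : Fin (n + 1) × Fin p → ℝ) :
    jZero p n c ⬝ᵥ v = ∑ i : Fin n, ∑ a, c (i, a) * v (i.castSucc, a) := by
  simp [dotProduct, Fintype.sum_prod_type, Fin.sum_univ_castSucc, jZero_castSucc, jZero_last]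

theorem jOne_dot (p n : ℕ) (c : Fin n × Fin p → ℝ) (v : Fin (n + 1) × Fin p → ℝ) :
    jOne p n c ⬝ᵥ v = ∑ i : Fin n, ∑ a, c (i, a) * v (i.succ, a) := by
  simp [dotProduct, Fintype.sum_prod_type, Fin.sum_univ_succ, jOne_succ, jOne_zero]

theorem kMul_dot (p n : ℕ) (t : ℝ) (c : Fin n × Fin p → ℝ) (v : Fin (n + 1) × Fin p → ℝ) :
    kMul p n t c ⬝ᵥ v = ∑ i : Fin n, ∑ a, c (i, a) * (v (i.succ, a) - t * v (i.castSucc, a)) := by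
  simp only [kMul, LinearMap.sub_apply, LinearMap.smul_apply, sub_dotProduct, smul_dotProduct,
    jOne_dot, jZero_dot, smul_eq_mul, Finset.mul_sum, ← Finset.sum_sub_distrib]
  refine Finset.sum_congr rfl fun i _ => Finset.sum_congr rfl fun a _ => ?_
  ring

theorem jZero_inj (p n : ℕ) : Function.Injective (jZero p n) := by
  intro c d h
  ext ⟨i, a⟩
  have := congrFun h (i.castSucc, a)
  simpa [jZero_castSucc] using this

theorem kMul_inj (p n : ℕ) (t : ℝ) (c : Fin n × Fin p → ℝ) (h : kMul p n t c = 0) : c = 0 := by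
  have h1 : ∀ (i : Fin n) (a : Fin p), c (i, a) = t * jZero p n c (i.succ, a) := by
    intro i a
    have := congrFun h (i.succ, a)
    simp only [kMul, LinearMap.sub_apply, LinearMap.smul_apply, Pi.sub_apply, Pi.smul_apply,
      smul_eq_mul, jOne_succ, Pi.zero_apply] at this
    linarith
  have h2 : ∀ (i : Fin (n + 1)) (a : Fin p), jZero p n c (i, a) = 0 := by
    intro i a
    induction i using Fin.reverseInduction with
    | last => exact jZero_last p n c a
    | cast i ih => rw [jZero_castSucc, h1, ih, mul_zero]
  ext ⟨i, a⟩
  rw [← jZero_castSucc p n c, h2]; rfl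

theorem kMul_dot_loc (p n : ℕ) (t : ℝ) (S : ℕ → Matrix (Fin p) (Fin p) ℝ)
    (f w : Fin n × Fin p → ℝ) :
    kMul p n t f ⬝ᵥ (momentMatrix p n S *ᵥ jZero p n w) = f ⬝ᵥ (locMatrix p n t S *ᵥ w) := by
  rw [kMul_dot]
  simp only [mulVec, dotProduct_comm _ (jZero p n w), jZero_dot]
  simp only [mulVec, dotProduct, Fintype.sum_prod_type, momentMatrix, locMatrix, Finset.mul_sum,
    ← Finset.sum_sub_distrib]
  refine Finset.sum_congr rfl fun i _ => Finset.sum_congr rfl fun a _ =>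
    Finset.sum_congr rfl fun j _ => Finset.sum_congr rfl fun b _ => ?_
  simp only [Fin.val_succ, Fin.val_castSucc]
  rw [show i.1 + 1 + j.1 = i.1 + j.1 + 1 by ring]
  ring

theorem jZero_dot_loc (p n : ℕ) (t : ℝ) (S : ℕ → Matrix (Fin p) (Fin p) ℝ)
    (f w : Fin n × Fin p → ℝ) :
    jZero p n w ⬝ᵥ (momentMatrix p n S *ᵥ kMul p n t f) = w ⬝ᵥ (locMatrix p n t S *ᵥ f) := by
  rw [jZero_dot]
  simp only [mulVec, dotProduct_comm _ (kMul p n t f), kMul_dot]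
  simp only [mulVec, dotProduct, Fintype.sum_prod_type, momentMatrix, locMatrix, Finset.mul_sum]
  refine Finset.sum_congr rfl fun i _ => Finset.sum_congr rfl fun a _ =>
    Finset.sum_congr rfl fun j _ => Finset.sum_congr rfl fun b _ => ?_
  simp only [Fin.val_succ, Fin.val_castSucc]
  rw [show i.1 + (j.1 + 1) = i.1 + j.1 + 1 by ring]
  ring

/-- evaluation of a vector polynomial. -/
def evMap (p N : ℕ) (x : ℝ) : (Fin N × Fin p → ℝ) →ₗ[ℝ] (Fin p → ℝ) where
  toFun g := fun a => ∑ i : Fin N, x ^ i.1 * g (i, a)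
  map_add' c d := by
    ext a
    simp [mul_add, Finset.sum_add_distrib]
  map_smul' r c := by
    ext a
    simp only [Pi.smul_apply, smul_eq_mul, RingHom.id_apply, Finset.mul_sum]
    refine Finset.sum_congr rfl fun i _ => ?_
    ring

theorem evMap_kMul (p n : ℕ) (t x : ℝ) (f : Fin n × Fin p → ℝ) :
    evMap p (n + 1) x (kMul p n t f) = (x - t) • evMap p (n + 1) x (jZero p n f) := by
  have h0 : evMap p (n + 1) x (jZero p n f) = evMap p n x f := by
    ext a
    simp [evMap, Fin.sum_univ_castSucc, jZero_castSucc, jZero_last]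
  have h1 : evMap p (n + 1) x (jOne p n f) = x • evMap p n x f := by
    ext a
    simp only [evMap, LinearMap.coe_mk, AddHom.coe_mk, Fin.sum_univ_succ, jOne_succ, jOne_zero,
      Pi.smul_apply, smul_eq_mul, Finset.mul_sum, mul_zero, zero_add, Fin.val_succ]
    refine Finset.sum_congr rfl fun i _ => ?_
    ring
  rw [kMul, LinearMap.sub_apply, LinearMap.smul_apply, map_sub, map_smul, h0, h1, sub_smul]

theorem moment_form (p n ℓ : ℕ) (S : ℕ → Matrix (Fin p) (Fin p) ℝ)
    (x : Fin ℓ → ℝ) (A : Fin ℓ → Matrix (Fin p) (Fin p) ℝ)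
    (hS : ∀ i ≤ 2 * n, S i = ∑ j, x j ^ i • A j) (h g : Fin (n + 1) × Fin p → ℝ) :
    h ⬝ᵥ (momentMatrix p n S *ᵥ g) =
      ∑ j, evMap p (n + 1) (x j) h ⬝ᵥ (A j *ᵥ evMap p (n + 1) (x j) g) := by
  have h1 : ∀ q, (momentMatrix p n S *ᵥ g) q =
      ∑ j, x j ^ q.1.1 * (A j *ᵥ evMap p (n + 1) (x j) g) q.2 := by
    intro q
    simp only [mulVec, dotProduct, momentMatrix, Fintype.sum_prod_type, evMap, LinearMap.coe_mk,
      AddHom.coe_mk, Finset.mul_sum]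
    have h2 : ∀ k : Fin (n + 1), ∀ b, S (q.1.1 + k.1) q.2 b * g (k, b) =
        ∑ j, x j ^ q.1.1 * (A j q.2 b * (x j ^ k.1 * g (k, b))) := by
      intro k b
      rw [hS _ (by omega), Matrix.sum_apply, Finset.sum_mul]
      refine Finset.sum_congr rfl fun j _ => ?_
      rw [Matrix.smul_apply, smul_eq_mul, pow_add]
      ring
    simp only [h2]
    rw [Finset.sum_comm]
    simp only [fun b => Finset.sum_comm (s := (Finset.univ : Finset (Fin (n + 1))))
      (t := (Finset.univ : Finset (Fin ℓ)))
      (f := fun k j => x j ^ q.1.1 * (A j q.2 b * (x j ^ k.1 * g (k, b))))]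
    rw [Finset.sum_comm]
  simp only [dotProduct, h1, Fintype.sum_prod_type, Finset.mul_sum]
  have e1 : ∀ (j : Fin ℓ) (a : Fin p), evMap p (n + 1) (x j) h a = ∑ i : Fin (n + 1),
    x j ^ i.1 * h (i, a) := fun j a => rfl
  simp only [e1, Finset.sum_mul]
  rw [Finset.sum_comm]
  simp only [fun b => Finset.sum_comm (s := (Finset.univ : Finset (Fin (n + 1))))
      (t := (Finset.univ : Finset (Fin ℓ)))
      (f := fun k j => h (k, b) * (x j ^ k.1 * (A j *ᵥ evMap p (n + 1) (x j) g) b))]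
  rw [Finset.sum_comm]
  refine Finset.sum_congr rfl fun i _ => Finset.sum_congr rfl fun a _ =>
    Finset.sum_congr rfl fun j _ => ?_
  ring

theorem forward_dir (p n : ℕ) (hn : 1 ≤ n)
    (S : ℕ → Matrix (Fin p) (Fin p) ℝ)
    (hM : (momentMatrix p n S).PosDef)
    (t : ℝ) (m ℓ : ℕ) (x : Fin ℓ → ℝ) (A : Fin ℓ → Matrix (Fin p) (Fin p) ℝ)
    (hA : IsMinimalRepMeasure p n ℓ S x A) (hmult : MultiplicityEq ℓ x A t m) :
    m + (n - 1) * p ≤ (locMatrix p n t S).rank := by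
  classical
  obtain ⟨hinj, hpos, hS, hrank⟩ := hA
  have hdef : ∀ g, g ⬝ᵥ (momentMatrix p n S *ᵥ g) = 0 → g = 0 := by
    intro g hg
    by_contra hne
    have := hM.dotProduct_mulVec_pos hne
    rw [star_trivial, hg] at this
    exact lt_irrefl _ this
  -- the total rank off `t`
  have hoff : ∑ j : {j // x j ≠ t}, (A j.1).rank + m = (n + 1) * p := by
    have e : ∑ j : {j // x j ≠ t}, (A j.1).rank =
        ∑ j ∈ Finset.univ.filter (fun j => x j ≠ t), (A j).rank :=
      (Finset.sum_subtype (p := fun j => x j ≠ t) _ (by intro j; simp) (fun j => (A j).rank)).symm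
    rw [e, ← hrank, ← Finset.sum_filter_add_sum_filter_not Finset.univ (fun j => x j ≠ t)]
    congr 1
    rcases hmult with ⟨j0, hj0, hr⟩ | ⟨hne, rfl⟩
    · rw [← hr, Finset.sum_eq_single_of_mem j0 (by simp [hj0])]
      intro b hb hb'
      exfalso
      apply hb'
      apply hinj
      rw [hj0]
      simpa using hb
    · symm
      apply Finset.sum_eq_zero
      intro j hj
      simp [hne j] at hj
  let Ψ : (Fin (n + 1) × Fin p → ℝ) →ₗ[ℝ]
      ((j : {j // x j ≠ t}) → LinearMap.range (A j.1).mulVecLin) :=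
    LinearMap.pi fun j => (A j.1).mulVecLin.rangeRestrict ∘ₗ evMap p (n + 1) (x j.1)
  let E := LinearMap.ker Ψ
  have hEmem : ∀ e ∈ E, ∀ j, x j ≠ t → A j *ᵥ evMap p (n + 1) (x j) e = 0 := by
    intro e he j hj
    have h1 : Ψ e = 0 := he
    have h2 := congrArg Subtype.val (congrFun h1 ⟨j, hj⟩)
    simpa [Ψ] using h2
  have hEdim : m ≤ Module.finrank ℝ E := by
    have h1 := Ψ.finrank_range_add_finrank_ker
    have h2 := Submodule.finrank_le (LinearMap.range Ψ)
    rw [Module.finrank_pi_fintype] at h2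
    have h3 : ∑ j : {j // x j ≠ t}, Module.finrank ℝ (LinearMap.range (A j.1).mulVecLin) =
      ∑ j : {j // x j ≠ t}, (A j.1).rank := rfl
    rw [h3] at h2
    simp only [Module.finrank_fintype_fun_eq_card, Fintype.card_prod, Fintype.card_fin] at h1
    change _ + Module.finrank ℝ E = _ at h1
    omega
  -- orthogonality
  have hKE : ∀ f, ∀ e ∈ E, kMul p n t f ⬝ᵥ (momentMatrix p n S *ᵥ e) = 0 := by
    intro f e he
    rw [moment_form p n ℓ S x A hS]
    apply Finset.sum_eq_zero
    intro j _
    by_cases hj : x j = t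
    · rw [evMap_kMul, hj, sub_self, zero_smul, zero_dotProduct]
    · rw [hEmem e he j hj, dotProduct_zero]
  have hWE : ∀ w, jZero p n w ∈ E → w = 0 := by
    intro w hw
    apply kMul_inj p n t
    apply hdef
    rw [moment_form p n ℓ S x A hS]
    apply Finset.sum_eq_zero
    intro j _
    by_cases hj : x j = t
    · rw [evMap_kMul, hj, sub_self, zero_smul, zero_dotProduct]
    · rw [evMap_kMul, mulVec_smul, hEmem _ hw j hj, smul_zero, dotProduct_zero]
  let Z := LinearMap.ker (locMatrix p n t S).mulVecLin
  have hKW : ∀ f ∈ Z, ∀ w, kMul p n t f ⬝ᵥ (momentMatrix p n S *ᵥ jZero p n w) = 0 := by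
    intro f hf w
    have h1 : kMul p n t f ⬝ᵥ (momentMatrix p n S *ᵥ jZero p n w) =
        jZero p n w ⬝ᵥ (momentMatrix p n S *ᵥ kMul p n t f) := by
      have hT : (momentMatrix p n S)ᵀ = momentMatrix p n S := by
        have := hM.1
        rwa [Matrix.IsHermitian, conjTranspose_eq_transpose_of_trivial] at this
      rw [dotProduct_mulVec, ← mulVec_transpose, hT, dotProduct_comm]
    have h2 : locMatrix p n t S *ᵥ f = 0 := hf
    rw [h1, jZero_dot_loc, h2, dotProduct_zero]
  let Θ : ((Fin n × Fin p → ℝ) × E × Z) →ₗ[ℝ] (Fin (n + 1) × Fin p → ℝ) :=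
    (jZero p n).coprod (E.subtype.coprod (kMul p n t ∘ₗ Z.subtype))
  have hΘ : Function.Injective Θ := by
    rw [← LinearMap.ker_eq_bot, eq_bot_iff]
    rintro ⟨w, e, f⟩ h
    have h : jZero p n w + (e.1 + kMul p n t f.1) = 0 := by simpa [Θ] using h
    have hf0 : f.1 = 0 := by
      apply kMul_inj p n t
      apply hdef
      have h3 : kMul p n t f.1 = -(jZero p n w) - e.1 := by
        rw [← sub_eq_zero, ← h]; abel
      conv_lhs => rw [h3]
      conv_lhs => 
        enter [1]
        rw [← h3]
      rw [mulVec_sub, mulVec_neg, dotProduct_sub, dotProduct_neg, hKW f.1 f.2, hKE _ _ e.2]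
      simp
    rw [hf0, map_zero, add_zero] at h
    have hw0 : w = 0 := by
      apply hWE
      rw [eq_neg_of_add_eq_zero_left h]
      exact E.neg_mem e.2
    rw [hw0, map_zero, zero_add] at h
    rw [Submodule.mem_bot]
    ext1
    · exact hw0
    · ext1
      · exact Subtype.ext h
      · exact Subtype.ext hf0
  have h1 := LinearMap.finrank_le_finrank_of_injective hΘ
  have h2 := (locMatrix p n t S).mulVecLin.finrank_range_add_finrank_ker
  change (locMatrix p n t S).rank + Module.finrank ℝ Z = _ at h2
  simp only [Module.finrank_prod, Module.finrank_fintype_fun_eq_card, Fintype.card_prod,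
    Fintype.card_fin] at h1 h2
  obtain ⟨k, rfl⟩ : ∃ k, n = k + 1 := ⟨n - 1, by omega⟩
  simp only [Nat.add_sub_cancel]
  have e1 : (k + 1 + 1) * p = k * p + p + p := by ring
  have e2 : (k + 1) * p = k * p + p := by ring
  rw [e1, e2] at h1
  rw [e2] at h2
  omega

theorem measure_of_vectors (p n N m : ℕ) (S : ℕ → Matrix (Fin p) (Fin p) ℝ) (t : ℝ)
    (lam : Fin N → ℝ) (u : Fin N → Fin p → ℝ)
    (hS : ∀ i ≤ 2 * n, S i = ∑ j, lam j ^ i • vecMulVec (u j) (u j))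
    (hN : N = (n + 1) * p)
    (hli : ∀ y, LinearIndependent ℝ (fun j : {j // lam j = y} => u j.1))
    (hm : (Finset.univ.filter fun j => lam j = t).card = m) :
    ∃ (ℓ : ℕ) (x : Fin ℓ → ℝ) (A : Fin ℓ → Matrix (Fin p) (Fin p) ℝ),
        IsMinimalRepMeasure p n ℓ S x A ∧ MultiplicityEq ℓ x A t m := by
  classical
  let s : Finset ℝ := Finset.univ.image lam
  let B : (y : ℝ) → Matrix {j // lam j = y} (Fin p) ℝ := fun y => Matrix.of fun j => u j.1
  let A : ℝ → Matrix (Fin p) (Fin p) ℝ := fun y => (B y)ᵀ * B y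
  have hrank : ∀ y, (A y).rank = (Finset.univ.filter fun j => lam j = y).card := by
    intro y
    have h1 : (B y).rank = Fintype.card {j // lam j = y} := LinearIndependent.rank_matrix (hli y)
    rw [Matrix.rank_transpose_mul_self, h1, Fintype.card_subtype]
  have hAsum : ∀ y, A y = ∑ j ∈ Finset.univ.filter (fun j => lam j = y), vecMulVec (u j) (u j) := by
    intro y
    ext a b
    rw [Matrix.sum_apply, Finset.sum_subtype (p := fun j => lam j = y) (F := inferInstance) _
      (by intro j; simp) (fun j => vecMulVec (u j) (u j) a b)]
    simp [A, B, Matrix.mul_apply, vecMulVec_apply]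
  have hmemS : ∀ y ∈ s, 0 < (Finset.univ.filter fun j => lam j = y).card := by
    intro y hy
    obtain ⟨j, -, rfl⟩ := Finset.mem_image.1 hy
    exact Finset.card_pos.2 ⟨j, by simp⟩
  refine ⟨s.card, fun j => (s.equivFin.symm j : ℝ), fun j => A (s.equivFin.symm j : ℝ),
    ⟨?_, ?_, ?_, ?_⟩, ?_⟩
  · intro i j hij
    exact s.equivFin.symm.injective (Subtype.ext hij)
  · intro j
    constructor
    · intro h0
      change A (s.equivFin.symm j : ℝ) = 0 at h0
      have h1 := hmemS _ (s.equivFin.symm j).2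
      rw [← hrank, h0, Matrix.rank_zero] at h1
      exact lt_irrefl _ h1
    · have := posSemidef_conjTranspose_mul_self (B (s.equivFin.symm j : ℝ))
      rwa [conjTranspose_eq_transpose_of_trivial] at this
  · intro i hi
    rw [hS i hi]
    rw [Equiv.sum_comp s.equivFin.symm (fun y : s => (y : ℝ) ^ i • A y),
      Finset.sum_coe_sort s (fun y : ℝ => y ^ i • A y)]
    rw [← Finset.sum_fiberwise_of_maps_to (s := Finset.univ) (t := s) (g := lam)
      (fun j _ => Finset.mem_image_of_mem _ (Finset.mem_univ j))]
    refine Finset.sum_congr rfl fun y _ => ?_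
    rw [hAsum, Finset.smul_sum]
    refine Finset.sum_congr rfl fun j hj => ?_
    rw [(Finset.mem_filter.1 hj).2]
  · rw [Equiv.sum_comp s.equivFin.symm (fun y : s => (A y).rank),
      Finset.sum_coe_sort s (fun y : ℝ => (A y).rank), ← hN]
    simp only [hrank]
    rw [← Finset.card_eq_sum_card_image]
    simp
  · by_cases ht : t ∈ s
    · left
      refine ⟨s.equivFin ⟨t, ht⟩, by simp, ?_⟩
      simp only [Equiv.symm_apply_apply]
      rw [hrank, hm]
    · right
      refine ⟨fun j hj => ht ?_, ?_⟩
      · rw [← hj]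
        exact (s.equivFin.symm j).2
      · rw [← hm, Finset.card_eq_zero, Finset.filter_eq_empty_iff]
        intro j _ hj
        exact ht (hj ▸ Finset.mem_image_of_mem _ (Finset.mem_univ j))

open scoped MatrixOrder in
theorem exists_gram {ι : Type*} [Fintype ι] [DecidableEq ι] (M : Matrix ι ι ℝ) (hM : M.PosDef) :
    ∃ Φ : (ι → ℝ) ≃ₗ[ℝ] EuclideanSpace ℝ ι, ∀ f g, inner ℝ (Φ f) (Φ g) = f ⬝ᵥ (M *ᵥ g) := by
  obtain ⟨B, hB⟩ := CStarAlgebra.nonneg_iff_eq_star_mul_self.mp hM.posSemidef.nonneg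
  have hB' : M = Bᵀ * B := by
    rw [hB, star_eq_conjTranspose, conjTranspose_eq_transpose_of_trivial]
  let φ : (ι → ℝ) →ₗ[ℝ] EuclideanSpace ℝ ι :=
    (WithLp.linearEquiv 2 ℝ (ι → ℝ)).symm.toLinearMap ∘ₗ B.mulVecLin
  have hφ : ∀ f g, inner ℝ (φ f) (φ g) = f ⬝ᵥ (M *ᵥ g) := by
    intro f g
    have h1 : inner ℝ (φ f) (φ g) = (B *ᵥ g) ⬝ᵥ (B *ᵥ f) := by
      simp [φ, EuclideanSpace.inner_eq_star_dotProduct]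
    rw [h1, hB', ← mulVec_mulVec, dotProduct_mulVec f, vecMul_transpose, dotProduct_comm]
  have hinj : Function.Injective φ := by
    rw [← LinearMap.ker_eq_bot, eq_bot_iff]
    intro f hf
    rw [LinearMap.mem_ker] at hf
    have h1 := hφ f f
    rw [hf, inner_zero_left] at h1
    by_contra hne
    have := hM.dotProduct_mulVec_pos (x := f) hne
    rw [star_trivial, ← h1] at this
    exact lt_irrefl _ this
  exact ⟨LinearEquiv.ofInjectiveOfFinrankEq φ hinj (by simp), hφ⟩

theorem backward_core {V : Type*} [NormedAddCommGroup V] [InnerProductSpace ℝ V]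
    [FiniteDimensional ℝ V] (p n : ℕ) (hn : 1 ≤ n)
    (S : ℕ → Matrix (Fin p) (Fin p) ℝ)
    (Φ : (Fin (n + 1) × Fin p → ℝ) ≃ₗ[ℝ] V)
    (hΦ : ∀ f g, inner ℝ (Φ f) (Φ g) = f ⬝ᵥ (momentMatrix p n S *ᵥ g))
    (t : ℝ) (m : ℕ) (hm : m + (n - 1) * p ≤ (locMatrix p n t S).rank) :
    ∃ (ℓ : ℕ) (x : Fin ℓ → ℝ) (A : Fin ℓ → Matrix (Fin p) (Fin p) ℝ),
        IsMinimalRepMeasure p n ℓ S x A ∧ MultiplicityEq ℓ x A t m := by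
  classical
  let rst : (Fin (n + 1) × Fin p → ℝ) →ₗ[ℝ] (Fin n × Fin p → ℝ) :=
    LinearMap.funLeft ℝ ℝ (fun r : Fin n × Fin p => (r.1.castSucc, r.2))
  have hrst : ∀ c, rst (jZero p n c) = c := by
    intro c
    ext ⟨i, a⟩
    exact jZero_castSucc p n c i a
  let K : V →ₗ[ℝ] V := Φ.toLinearMap ∘ₗ kMul p n t ∘ₗ rst ∘ₗ Φ.symm.toLinearMap
  have hKJ : ∀ c, K (Φ (jZero p n c)) = Φ (kMul p n t c) := by
    intro c
    simp only [K, LinearMap.comp_apply, LinearEquiv.coe_coe, LinearEquiv.symm_apply_apply, hrst]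
  let J : (Fin n × Fin p → ℝ) →ₗ[ℝ] V := Φ.toLinearMap ∘ₗ jZero p n
  have hJ : ∀ c, J c = Φ (jZero p n c) := fun c => rfl
  have hfrV : Module.finrank ℝ V = (n + 1) * p := by simp [← Φ.finrank_eq]
  have hZr := (locMatrix p n t S).mulVecLin.finrank_range_add_finrank_ker
  change (locMatrix p n t S).rank + _ = _ at hZr
  simp only [Module.finrank_fintype_fun_eq_card, Fintype.card_prod, Fintype.card_fin] at hZr
  have hWr := LinearMap.finrank_range_le J
  simp only [Module.finrank_fintype_fun_eq_card, Fintype.card_prod, Fintype.card_fin] at hWr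
  obtain ⟨K', hK'1, hK'2, hK'3⟩ := ext_sym_ker (LinearMap.range J) K (by
      rintro _ ⟨c, rfl⟩ _ ⟨d, rfl⟩
      rw [hJ, hJ, hKJ, hKJ, hΦ, hΦ, kMul_dot_loc, jZero_dot_loc]) (by
      rintro _ ⟨c, rfl⟩ h
      rw [hJ, hKJ] at h
      rw [kMul_inj p n t c (by simpa using h), map_zero])
    ((LinearMap.ker (locMatrix p n t S).mulVecLin).map J) (by
      rintro _ ⟨c, rfl⟩ h
      refine Submodule.mem_map_of_mem ?_
      rw [LinearMap.mem_ker, mulVecLin_apply]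
      rw [← dotProduct_self_eq_zero]
      have := h (J (locMatrix p n t S *ᵥ c)) ⟨_, rfl⟩
      rw [hJ, hJ, hKJ, real_inner_comm, hΦ, jZero_dot_loc] at this
      exact this) m (by
      have h1 := Submodule.finrank_map_le J (LinearMap.ker (locMatrix p n t S).mulVecLin)
      rw [hfrV]
      obtain ⟨k, rfl⟩ : ∃ k, n = k + 1 := ⟨n - 1, by omega⟩
      simp only [Nat.add_sub_cancel] at hm
      have e1 : (k + 1 + 1) * p = k * p + p + p := by ring
      have e2 : (k + 1) * p = k * p + p := by ring
      rw [e1]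
      rw [e2] at hZr hWr
      omega)
  let T : V →ₗ[ℝ] V := K' + t • LinearMap.id
  have hT : T.IsSymmetric := by
    intro x y
    simp only [T, LinearMap.add_apply, LinearMap.smul_apply, LinearMap.id_apply, inner_add_left,
      inner_add_right, inner_smul_left, inner_smul_right, RCLike.conj_to_real]
    rw [hK'2 x y]
  let e : Fin (n + 1) → Fin p → V := fun i a => Φ (Pi.single (i, a) 1)
  have hTe : ∀ (i : Fin n) a, T (e i.castSucc a) = e i.succ a := by
    intro i a
    have h0 : (Pi.single (i.castSucc, a) 1 : Fin (n + 1) × Fin p → ℝ) =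
        jZero p n (Pi.single (i, a) 1) := by
      ext ⟨k, b⟩
      refine Fin.lastCases ?_ (fun k => ?_) k
      · rw [jZero_last, Pi.single_apply, if_neg]
        intro h
        have := congrArg (fun q => q.1.1) h
        have h3 := i.2
        simp at this
        omega
      · rw [jZero_castSucc]
        simp [Pi.single_apply]
    have h1 : (Pi.single (i.succ, a) 1 : Fin (n + 1) × Fin p → ℝ) =
        jOne p n (Pi.single (i, a) 1) := by
      ext ⟨k, b⟩
      refine Fin.cases ?_ (fun k => ?_) k
      · rw [jOne_zero, Pi.single_apply, if_neg]
        intro h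
        have := congrArg (fun q => q.1.1) h
        simp at this
      · rw [jOne_succ]
        simp [Pi.single_apply]
    simp only [e, T, LinearMap.add_apply, LinearMap.smul_apply, LinearMap.id_apply]
    rw [h0, h1, ← hJ, hK'1 _ ⟨_, rfl⟩, hJ, hKJ, ← map_smul, ← map_add]
    congr 1
    simp [kMul]
  have hee : ∀ i a j b, inner ℝ (e i a) (e j b) = S (i.1 + j.1) a b := by
    intro i a j b
    simp only [e]
    rw [hΦ]
    simp [momentMatrix]
  let bs := hT.eigenvectorBasis hfrV
  let lam := hT.eigenvalues hfrV
  have hbs : ∀ j, T (bs j) = lam j • bs j := fun j => hT.apply_eigenvectorBasis hfrV j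
  -- eigenvectors against monomials
  have hpow : ∀ (v : V) (y : ℝ), T v = y • v → ∀ (i : Fin (n + 1)) a,
      inner ℝ v (e i a) = y ^ i.1 * inner ℝ v (e 0 a) := by
    intro v y hv i a
    induction i using Fin.induction with
    | zero => simp
    | succ i ih =>
      rw [← hTe, ← hT v, hv, inner_smul_left, ih]
      simp only [RCLike.conj_to_real, Fin.val_succ, Fin.val_castSucc]
      ring
  have hzero : ∀ v : V, (∀ i a, inner ℝ v (e i a) = 0) → v = 0 := by
    intro v hv
    have h1 : ∀ c, inner ℝ v (Φ c) = 0 := by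
      intro c
      have : c = ∑ q, c q • (Pi.single q 1 : Fin (n + 1) × Fin p → ℝ) := by
        ext q
        simp [Finset.sum_apply, Pi.single_apply]
      rw [this, map_sum, inner_sum]
      apply Finset.sum_eq_zero
      intro q _
      rw [map_smul, inner_smul_right]
      have := hv q.1 q.2
      simp only [e] at this
      rw [this, mul_zero]
    have h2 := h1 (Φ.symm v)
    rw [LinearEquiv.apply_symm_apply] at h2
    simpa using h2
  refine measure_of_vectors p n _ m S t lam (fun j a => inner ℝ (bs j) (e 0 a)) ?_ rfl ?_ ?_
  · intro i hi
    obtain ⟨k, l, hk, hl, rfl⟩ : ∃ k l, k < n + 1 ∧ l < n + 1 ∧ k + l = i := by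
      by_cases h : i ≤ n
      · exact ⟨i, 0, by omega, by omega, by omega⟩
      · exact ⟨n, i - n, by omega, by omega, by omega⟩
    ext a b
    rw [Matrix.sum_apply, ← hee ⟨k, hk⟩ a ⟨l, hl⟩ b, ← bs.sum_inner_mul_inner]
    refine Finset.sum_congr rfl fun j _ => ?_
    rw [real_inner_comm, hpow _ _ (hbs j) ⟨k, hk⟩, hpow _ _ (hbs j) ⟨l, hl⟩, Matrix.smul_apply, vecMulVec_apply,
      smul_eq_mul, pow_add]
    ring
  · intro y
    rw [Fintype.linearIndependent_iff]
    intro c hc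
    let v : V := ∑ j : {j // lam j = y}, c j • bs j.1
    have hv : T v = y • v := by
      simp only [v, map_sum, map_smul, hbs, Finset.smul_sum]
      refine Finset.sum_congr rfl fun j _ => ?_
      rw [j.2, smul_comm]
    have hv0 : ∀ a, inner ℝ v (e 0 a) = 0 := by
      intro a
      have := congrFun hc a
      simp only [v, sum_inner, inner_smul_left, RCLike.conj_to_real]
      simpa [Finset.sum_apply] using this
    have hvz : v = 0 := hzero v fun i a => by rw [hpow v y hv, hv0, mul_zero]
    have hli : LinearIndependent ℝ (fun j : {j // lam j = y} => bs j.1) :=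
      bs.orthonormal.linearIndependent.comp _ Subtype.val_injective
    exact Fintype.linearIndependent_iff.1 hli c hvz
  · have h1 := hT.card_filter_eigenvalues_eq hfrV t
    have h2 : Module.End.eigenspace T t = LinearMap.ker K' := by
      ext v
      rw [Module.End.mem_eigenspace_iff, LinearMap.mem_ker]
      simp [T]
    rw [h2, hK'3] at h1
    exact h1

/-- Theorem 1.1: existence of a minimal representing measure with multiplicity `m` at `t`
is equivalent to `m ≤ rank H_{x-t}(n-1) - (n-1)p`. -/
theorem gaussian_quadrature_prescribed_atom_iff (p n : ℕ) (hp : 1 ≤ p) (hn : 1 ≤ n)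
    (S : ℕ → Matrix (Fin p) (Fin p) ℝ)
    (hSsym : ∀ i ≤ 2 * n, (S i).IsSymm)
    (hM : (momentMatrix p n S).PosDef)
    (t : ℝ) (m : ℕ) :
    (∃ (ℓ : ℕ) (x : Fin ℓ → ℝ) (A : Fin ℓ → Matrix (Fin p) (Fin p) ℝ),
        IsMinimalRepMeasure p n ℓ S x A ∧ MultiplicityEq ℓ x A t m) ↔
      m + (n - 1) * p ≤ (locMatrix p n t S).rank := by
  constructor
  · rintro ⟨ℓ, x, A, hA, hmult⟩
    exact forward_dir p n hn S hM t m ℓ x A hA hmult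
  · intro hm
    obtain ⟨Φ, hΦ⟩ := exists_gram _ hM
    exact backward_core p n hn S Φ hΦ t m hm
end

section
/- Let p, n ≥ 1, let S = (S_0, …, S_{2n}) be a truncated matrix moment sequence whose moment matrix M(n) is positive definite, let t ∈ ℝ, and assume the (x−t)-localizing moment matrix H_{x−t}(n−1) is invertible (rank np). Then there exists a minimal representing measure for S whose multiplicity at t equals p, and it is unique: if (x_1,…,x_ℓ; A_1,…,A_ℓ) and (y_1,…,y_k; B_1,…,B_k) are both minimal representing measures for S with multiplicity p at t, then they define the same measure, i.e., for every s ∈ ℝ the mass at s agrees (the mass at s being A_j if s = x_j for some j and the zero matrix otherwise, respectively B_j if s = y_j and zero otherwise). -/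
open Matrix

section Helpers

lemma real_spectral {κ : Type*} [Fintype κ] [DecidableEq κ] (A : Matrix κ κ ℝ) (hA : A.IsHermitian) :
    ∃ (Q : Matrix κ κ ℝ), Qᵀ * Q = 1 ∧ Q * Qᵀ = 1 ∧
      A = Q * diagonal hA.eigenvalues * Qᵀ := by
  have hs : star (hA.eigenvectorUnitary : Matrix κ κ ℝ) =
      (hA.eigenvectorUnitary : Matrix κ κ ℝ)ᵀ := by
    rw [star_eq_conjTranspose, conjTranspose_eq_transpose_of_trivial]
  refine ⟨(hA.eigenvectorUnitary : Matrix κ κ ℝ), ?_, ?_, ?_⟩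
  · rw [← hs]; exact Unitary.coe_star_mul_self _
  · rw [← hs]; exact Unitary.coe_mul_star_self _
  · rw [← hs]
    have h := hA.spectral_theorem
    rw [Unitary.conjStarAlgAut_apply] at h
    exact h

lemma psd_decomp {p : ℕ} (A : Matrix (Fin p) (Fin p) ℝ) (hA : A.PosSemidef) :
    ∃ (u : Fin p → Fin p → ℝ) (P : Finset (Fin p)), P.card = A.rank ∧ (∀ c, c ∉ P → u c = 0) ∧
      ∀ a b, A a b = ∑ c, u c a * u c b := by
  obtain ⟨Q, h1, h2, h3⟩ := real_spectral A hA.1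
  refine ⟨fun c a => Real.sqrt (hA.1.eigenvalues c) * Q a c,
    Finset.univ.filter (fun c => hA.1.eigenvalues c ≠ 0), ?_, ?_, ?_⟩
  · rw [hA.1.rank_eq_card_non_zero_eigs, Fintype.card_subtype]
  · intro c hc
    have : hA.1.eigenvalues c = 0 := by simpa using hc
    funext a; simp [this]
  · intro a b
    conv_lhs => rw [h3]
    rw [Matrix.mul_apply]
    refine Finset.sum_congr rfl fun c _ => ?_
    rw [Matrix.mul_diagonal, Matrix.transpose_apply]
    have := Real.mul_self_sqrt (hA.eigenvalues_nonneg c)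
    linear_combination (- Q a c * Q b c) * this

lemma posDef_factor {κ : Type*} [Fintype κ] [DecidableEq κ] (M : Matrix κ κ ℝ) (hM : M.PosDef) :
    ∃ G : Matrix κ κ ℝ, Gᵀ * G = M := by
  obtain ⟨Q, h1, h2, h3⟩ := real_spectral M hM.1
  refine ⟨diagonal (fun c => Real.sqrt (hM.1.eigenvalues c)) * Qᵀ, ?_⟩
  conv_rhs => rw [h3]
  rw [transpose_mul, transpose_transpose, diagonal_transpose]
  rw [Matrix.mul_assoc, ← Matrix.mul_assoc (diagonal _) (diagonal _), diagonal_mul_diagonal,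
    ← Matrix.mul_assoc]
  congr 3
  funext c
  exact Real.mul_self_sqrt (hM.posSemidef.eigenvalues_nonneg c)

lemma det_unit_of_rank {κ : Type*} [Fintype κ] [DecidableEq κ] (H : Matrix κ κ ℝ)
    (h : H.rank = Fintype.card κ) : IsUnit H.det := by
  rw [← Matrix.isUnit_iff_isUnit_det, ← Matrix.linearIndependent_cols_iff_isUnit,
    linearIndependent_iff_card_eq_finrank_span, ← h, Matrix.rank_eq_finrank_span_cols]
  rfl

lemma rank_factor {κ ι : Type*} [Fintype κ] [DecidableEq κ] [Fintype ι] [DecidableEq ι]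
    (T : Matrix κ κ ℝ) (hT : Tᵀ = T) (J : Matrix κ ι ℝ) (H : Matrix ι ι ℝ)
    (hH : H = Jᵀ * (T * J)) (hHu : IsUnit H.det) (hr : T.rank ≤ Fintype.card ι) :
    T = (T * J) * H⁻¹ * (T * J)ᵀ := by
  have hle : LinearMap.range (T * J).mulVecLin ≤ LinearMap.range T.mulVecLin := by
    rw [Matrix.mulVecLin_mul]
    exact LinearMap.range_comp_le_range _ _
  have h1 : H.rank = Fintype.card ι := Matrix.rank_of_isUnit H ((Matrix.isUnit_iff_isUnit_det H).2 hHu)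
  have h2 : H.rank ≤ (T * J).rank := by rw [hH]; exact Matrix.rank_mul_le_right _ _
  have heq := Submodule.eq_of_le_of_finrank_le hle (by
    change T.rank ≤ (T * J).rank
    omega)
  have hK : ∀ k : κ, ∃ v : ι → ℝ, (T * J) *ᵥ v = T *ᵥ Pi.single k 1 := by
    intro k
    have : T *ᵥ Pi.single k 1 ∈ LinearMap.range (T * J).mulVecLin := by
      rw [heq]; exact ⟨_, rfl⟩
    exact this
  choose v hv using hK
  have hK : (T * J) * (Matrix.of v)ᵀ = T := by
    ext a k
    have := congrFun (hv k) a
    rw [Matrix.mulVec_single_one] at this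
    rw [Matrix.mul_apply]
    exact this
  have h3 : H * (Matrix.of v)ᵀ = (T * J)ᵀ := by
    rw [hH, Matrix.mul_assoc, hK, transpose_mul, hT]
  rw [Matrix.mul_assoc, ← h3, ← Matrix.mul_assoc H⁻¹, Matrix.nonsing_inv_mul _ hHu, Matrix.one_mul, hK]

variable {p n : ℕ}

def csM (p n : ℕ) : Fin n × Fin p → Fin (n+1) × Fin p := fun k => (k.1.castSucc, k.2)
def scM (p n : ℕ) : Fin n × Fin p → Fin (n+1) × Fin p := fun k => (k.1.succ, k.2)

/-- coefficient matrix of multiplication by `x - t` -/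
noncomputable def DM (p n : ℕ) (t : ℝ) : Matrix (Fin (n+1) × Fin p) (Fin n × Fin p) ℝ :=
  (1 : Matrix (Fin (n+1) × Fin p) (Fin (n+1) × Fin p) ℝ).submatrix id (scM p n) -
  t • (1 : Matrix (Fin (n+1) × Fin p) (Fin (n+1) × Fin p) ℝ).submatrix id (csM p n)

lemma mul_DM_apply {κ : Type*} (t : ℝ) (G : Matrix κ (Fin (n+1) × Fin p) ℝ) (a : κ)
    (k : Fin n × Fin p) :
    (G * DM p n t) a k = G a (scM p n k) - t * G a (csM p n k) := by
  rw [DM, Matrix.mul_sub, Matrix.mul_smul]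
  simp [Matrix.mul_apply, Matrix.one_apply]

lemma loc_eq (t : ℝ) (S : ℕ → Matrix (Fin p) (Fin p) ℝ) {κ : Type*} [Fintype κ]
    (G : Matrix κ (Fin (n+1) × Fin p) ℝ) (hG : Gᵀ * G = momentMatrix p n S) :
    locMatrix p n t S = (G.submatrix id (csM p n))ᵀ * (G * DM p n t) := by
  have : (G.submatrix id (csM p n))ᵀ = Gᵀ.submatrix (csM p n) id := rfl
  rw [this, ← Matrix.submatrix_id_id (G * DM p n t),
    ← Matrix.submatrix_mul _ _ _ id _ Function.bijective_id, ← Matrix.mul_assoc, hG]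
  ext a b
  rw [Matrix.submatrix_apply, mul_DM_apply]
  simp [locMatrix, momentMatrix, csM, scM, add_assoc]

lemma loc_symm (t : ℝ) (S : ℕ → Matrix (Fin p) (Fin p) ℝ)
    (hS : ∀ i ≤ 2 * n, (S i).IsSymm) : (locMatrix p n t S)ᵀ = locMatrix p n t S := by
  ext a b
  simp only [locMatrix, transpose_apply]
  have e : (b.1 : ℕ) + a.1 = a.1 + b.1 := add_comm _ _
  rw [e, (hS (a.1 + b.1 + 1) (by omega)).apply, (hS (a.1 + b.1) (by omega)).apply]

lemma moment_unique (t : ℝ) (S : ℕ → Matrix (Fin p) (Fin p) ℝ)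
    (hH : (locMatrix p n t S).rank = n * p) {κ : Type*} [Fintype κ] [DecidableEq κ]
    (l : κ → ℝ) (u : κ → Fin p → ℝ)
    (hS : ∀ i ≤ 2 * n, ∀ a b, S i a b = ∑ k, l k ^ i * (u k a * u k b))
    (hc : Fintype.card {k // l k - t ≠ 0} ≤ n * p) (m : ℕ) (a b : Fin p) :
    ∑ k, (l k - t) ^ m * (u k a * u k b) =
      (momentMatrix p n S * (DM p n t * (locMatrix p n t S)⁻¹ * (DM p n t)ᵀ *
        momentMatrix p n S) ^ m) (0, a) (0, b) := by
  set T : Matrix κ κ ℝ := diagonal (fun k => l k - t) with hT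
  set G : Matrix κ (Fin (n+1) × Fin p) ℝ := fun k i => l k ^ (i.1 : ℕ) * u k i.2 with hGd
  have hGa : ∀ k i, G k i = l k ^ (i.1 : ℕ) * u k i.2 := fun _ _ => rfl
  clear_value G
  have hG : Gᵀ * G = momentMatrix p n S := by
    ext i j
    rw [Matrix.mul_apply, momentMatrix, hS _ (by omega)]
    refine Finset.sum_congr rfl fun k _ => ?_
    simp only [transpose_apply, hGa]; ring
  have hTJ : T * G.submatrix id (csM p n) = G * DM p n t := by
    ext k i
    rw [mul_DM_apply, hT, Matrix.diagonal_mul]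
    simp only [hGa, submatrix_apply, csM, scM, id, Fin.val_succ, Fin.val_castSucc]; ring
  have hf := rank_factor T (by simp [hT]) (G.submatrix id (csM p n)) (locMatrix p n t S)
    (by rw [hTJ, ← loc_eq t S G hG]) (det_unit_of_rank _ (by simp [hH]))
    (by rw [hT, Matrix.rank_diagonal]; simpa using hc)
  rw [hTJ] at hf
  set That := DM p n t * (locMatrix p n t S)⁻¹ * (DM p n t)ᵀ * momentMatrix p n S with hThat
  have hTG : T * G = G * That := by
    conv_lhs => rw [hf]
    rw [hThat, ← hG, transpose_mul]
    simp only [Matrix.mul_assoc]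
  have hpow : ∀ m : ℕ, T ^ m * G = G * That ^ m := by
    intro m
    induction m with
    | zero => simp
    | succ m ih => rw [pow_succ, Matrix.mul_assoc, hTG, ← Matrix.mul_assoc, ih, Matrix.mul_assoc, ← pow_succ]
  rw [← hG, Matrix.mul_assoc, ← hpow, hT, Matrix.diagonal_pow, Matrix.mul_apply]
  refine Finset.sum_congr rfl fun k _ => ?_
  rw [Matrix.diagonal_mul]
  simp only [hGa, transpose_apply, Pi.pow_apply, Fin.val_zero, pow_zero]; ring

lemma measure_moments (t : ℝ) (S : ℕ → Matrix (Fin p) (Fin p) ℝ)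
    (hH : (locMatrix p n t S).rank = n * p) {ℓ : ℕ} (x : Fin ℓ → ℝ)
    (A : Fin ℓ → Matrix (Fin p) (Fin p) ℝ) (h : IsMinimalRepMeasure p n ℓ S x A)
    (ht : ∃ j, x j = t ∧ (A j).rank = p) (m : ℕ) (a b : Fin p) :
    ∑ j, (x j - t) ^ m * A j a b =
      (momentMatrix p n S * (DM p n t * (locMatrix p n t S)⁻¹ * (DM p n t)ᵀ *
        momentMatrix p n S) ^ m) (0, a) (0, b) := by
  obtain ⟨hinj, hA, hS, hr⟩ := h
  obtain ⟨j0, hj0, hj0r⟩ := ht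
  choose u P hP hP0 hu using fun j => psd_decomp (A j) (hA j).2
  have key : ∀ (f : ℝ → ℝ) a b, ∑ k : Fin ℓ × Fin p,
      f (if k.2 ∈ P k.1 then x k.1 else t) * (u k.1 k.2 a * u k.1 k.2 b) =
      ∑ j, f (x j) * A j a b := by
    intro f a b
    rw [Fintype.sum_prod_type]
    refine Finset.sum_congr rfl fun j _ => ?_
    rw [hu, Finset.mul_sum]
    refine Finset.sum_congr rfl fun c _ => ?_
    by_cases hc : c ∈ P j
    · simp [hc]
    · simp [hP0 j c hc]
  rw [← moment_unique t S hH (κ := Fin ℓ × Fin p) (fun k => if k.2 ∈ P k.1 then x k.1 else t)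
    (fun k => u k.1 k.2) ?_ ?_ m a b]
  · exact (key (fun y => (y - t) ^ m) a b).symm
  · intro i hi a b
    rw [key (fun y => y ^ i) a b, hS i hi, Matrix.sum_apply]
    rfl
  · rw [Fintype.card_subtype]
    have hsub : (Finset.univ.filter fun k : Fin ℓ × Fin p =>
        (if k.2 ∈ P k.1 then x k.1 else t) - t ≠ 0) ⊆
        ((Finset.univ.erase j0).sigma P).map (Equiv.sigmaEquivProd (Fin ℓ) (Fin p)).toEmbedding := by
      intro k hk
      rw [Finset.mem_filter] at hk
      by_cases hkP : k.2 ∈ P k.1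
      · simp only [Finset.mem_map_equiv, Finset.mem_sigma, Finset.mem_erase, Finset.mem_univ, and_true]
        refine ⟨?_, hkP⟩
        intro he
        have he' : k.1 = j0 := he
        apply hk.2
        rw [if_pos hkP, he', hj0, sub_self]
      · simp [hkP] at hk
    refine (Finset.card_le_card hsub).trans ?_
    rw [Finset.card_map, Finset.card_sigma]
    have := Finset.add_sum_erase Finset.univ (fun j => (A j).rank) (Finset.mem_univ j0)
    simp only [hP]
    rw [hr, hj0r, Nat.add_mul] at this
    omega

lemma mass_of_moments {ℓ₁ ℓ₂ : ℕ} (t : ℝ) (x₁ : Fin ℓ₁ → ℝ) (x₂ : Fin ℓ₂ → ℝ)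
    (w₁ : Fin ℓ₁ → ℝ) (w₂ : Fin ℓ₂ → ℝ)
    (h : ∀ m : ℕ, ∑ j, (x₁ j - t) ^ m * w₁ j = ∑ j, (x₂ j - t) ^ m * w₂ j) (s : ℝ) :
    ∑ j ∈ Finset.univ.filter (fun j => x₁ j = s), w₁ j =
      ∑ j ∈ Finset.univ.filter (fun j => x₂ j = s), w₂ j := by
  classical
  have hq : ∀ q : Polynomial ℝ, ∑ j, q.eval (x₁ j - t) * w₁ j = ∑ j, q.eval (x₂ j - t) * w₂ j := by
    intro q
    simp only [Polynomial.eval_eq_sum_range, Finset.sum_mul]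
    rw [Finset.sum_comm, Finset.sum_comm (s := Finset.univ)]
    refine Finset.sum_congr rfl fun m _ => ?_
    simp only [mul_assoc, ← Finset.mul_sum, h]
  let E : Finset ℝ := (Finset.univ.image x₁ ∪ Finset.univ.image x₂).erase s
  let q : Polynomial ℝ := ∏ y ∈ E, (Polynomial.X - Polynomial.C (y - t))
  have hz : ∀ y ∈ E, q.eval (y - t) = 0 := by
    intro y hy
    rw [Polynomial.eval_prod]
    exact Finset.prod_eq_zero hy (by simp)
  have hs : q.eval (s - t) ≠ 0 := by
    rw [Polynomial.eval_prod, Finset.prod_ne_zero_iff]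
    intro y hy
    have := (Finset.mem_erase.1 hy).1
    simp only [Polynomial.eval_sub, Polynomial.eval_X, Polynomial.eval_C]
    intro h0; apply this; linarith
  have red : ∀ {ℓ : ℕ} (x w : Fin ℓ → ℝ), (∀ j, x j = s ∨ x j ∈ E) →
      ∑ j, q.eval (x j - t) * w j =
        q.eval (s - t) * ∑ j ∈ Finset.univ.filter (fun j => x j = s), w j := by
    intro ℓ x w hx
    rw [Finset.mul_sum, Finset.sum_filter]
    refine Finset.sum_congr rfl fun j _ => ?_
    by_cases hj : x j = s
    · simp [hj]
    · rw [if_neg hj, hz _ ((hx j).resolve_left hj), zero_mul]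
  have := hq q
  rw [red x₁ w₁, red x₂ w₂] at this
  · exact mul_left_cancel₀ hs this
  · intro j; by_cases hj : x₂ j = s
    · exact Or.inl hj
    · exact Or.inr (by simp [E, hj])
  · intro j; by_cases hj : x₁ j = s
    · exact Or.inl hj
    · exact Or.inr (by simp [E, hj])

lemma exists_atoms (t : ℝ) (S : ℕ → Matrix (Fin p) (Fin p) ℝ)
    (hSsym : ∀ i ≤ 2 * n, (S i).IsSymm)
    (hM : (momentMatrix p n S).PosDef)
    (hH : (locMatrix p n t S).rank = n * p) :
    ∃ (l : Fin (n+1) × Fin p → ℝ) (G : Matrix (Fin (n+1) × Fin p) (Fin (n+1) × Fin p) ℝ),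
      IsUnit G ∧ Gᵀ * G = momentMatrix p n S ∧
      (∀ k i, G k i = l k ^ (i.1 : ℕ) * G k (0, i.2)) ∧
      Fintype.card {k // l k = t} = p := by
  obtain ⟨B, hB⟩ := posDef_factor _ hM
  set H := locMatrix p n t S with hHd
  have hHu : IsUnit H.det := det_unit_of_rank _ (by rw [hH]; simp)
  set J := B.submatrix id (csM p n) with hJ
  obtain ⟨X, hX⟩ : ∃ X, X = B * DM p n t := ⟨_, rfl⟩
  have hHJ : H = Jᵀ * X := by rw [hX]; exact loc_eq t S B hB
  have hHs : Hᵀ = H := loc_symm t S hSsym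
  clear_value H J
  obtain ⟨T, hT⟩ : ∃ T, T = X * H⁻¹ * Xᵀ := ⟨_, rfl⟩
  have hTs : Tᵀ = T := by
    rw [hT, transpose_mul, transpose_mul, transpose_transpose, transpose_nonsing_inv, hHs,
      Matrix.mul_assoc]
  have hTJ : T * J = X := by
    have : Xᵀ * J = H := by rw [← hHs, hHJ, transpose_mul, transpose_transpose]
    rw [hT, Matrix.mul_assoc, this, Matrix.mul_assoc, Matrix.nonsing_inv_mul _ hHu, Matrix.mul_one]
  have hTr : T.rank = n * p := by
    apply le_antisymm
    · rw [hT]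
      refine (Matrix.rank_mul_le_right _ _).trans ((Matrix.rank_le_card_height _).trans ?_)
      simp
    · rw [← hH, hHJ, ← hTJ]
      exact (Matrix.rank_mul_le_right _ _).trans (Matrix.rank_mul_le_left _ _)
  have hTh : T.IsHermitian := by
    rw [IsHermitian, conjTranspose_eq_transpose_of_trivial, hTs]
  obtain ⟨Q, h1, h2, h3⟩ := real_spectral T hTh
  have hQT : Qᵀ * T = diagonal hTh.eigenvalues * Qᵀ := by
    conv_lhs => rw [h3]
    rw [← Matrix.mul_assoc, ← Matrix.mul_assoc, h1, Matrix.one_mul]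
  have hGG : (Qᵀ * B)ᵀ * (Qᵀ * B) = momentMatrix p n S := by
    rw [transpose_mul, transpose_transpose, Matrix.mul_assoc, ← Matrix.mul_assoc Q, h2,
      Matrix.one_mul, hB]
  refine ⟨fun k => hTh.eigenvalues k + t, Qᵀ * B, ?_, hGG, ?_, ?_⟩
  · have := hM.isUnit
    rw [← hGG] at this
    rw [Matrix.isUnit_iff_isUnit_det] at this ⊢
    rw [det_mul] at this
    exact isUnit_of_mul_isUnit_right this
  · have hstep : ∀ k (i : Fin n) (a : Fin p), (Qᵀ * B) k (i.succ, a) =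
        (hTh.eigenvalues k + t) * (Qᵀ * B) k (i.castSucc, a) := by
      intro k i a
      have e : (diagonal hTh.eigenvalues * (Qᵀ * B).submatrix id (csM p n)) =
          (Qᵀ * B) * DM p n t := by
        have : (Qᵀ * B).submatrix id (csM p n) = Qᵀ * J := by rw [hJ]; rfl
        rw [this, ← Matrix.mul_assoc, ← hQT, Matrix.mul_assoc, hTJ, hX, Matrix.mul_assoc]
      have e2 := congrFun (congrFun e k) (i, a)
      rw [Matrix.diagonal_mul, mul_DM_apply] at e2
      simp only [submatrix_apply, id, csM, scM] at e2
      linarith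
    rintro k ⟨i, a⟩
    induction i using Fin.induction with
    | zero => simp
    | succ i ih =>
      rw [hstep, ih]
      simp only [Fin.val_succ, Fin.val_castSucc]; ring
  · have hc := hTh.rank_eq_card_non_zero_eigs
    rw [hTr] at hc
    have h4 := Fintype.card_subtype_compl (fun k => hTh.eigenvalues k = 0)
    have h5 := Fintype.card_subtype_le (fun k => hTh.eigenvalues k = 0)
    simp only [Fintype.card_prod, Fintype.card_fin, Nat.add_mul, one_mul] at h4 h5
    have h6 : Fintype.card {k // hTh.eigenvalues k + t = t} =
        Fintype.card {k // hTh.eigenvalues k = 0} := by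
      simp only [add_eq_right]
    rw [h6]
    have h7 : Fintype.card {k // hTh.eigenvalues k ≠ 0} =
      Fintype.card {k // ¬ hTh.eigenvalues k = 0} := rfl
    omega

end Helpers

lemma exists_measure {p n : ℕ} (hp : 1 ≤ p) (t : ℝ) (S : ℕ → Matrix (Fin p) (Fin p) ℝ)
    (hSsym : ∀ i ≤ 2 * n, (S i).IsSymm)
    (hM : (momentMatrix p n S).PosDef)
    (hH : (locMatrix p n t S).rank = n * p) :
    ∃ (ℓ : ℕ) (x : Fin ℓ → ℝ) (A : Fin ℓ → Matrix (Fin p) (Fin p) ℝ),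
        IsMinimalRepMeasure p n ℓ S x A ∧ ∃ j, x j = t ∧ (A j).rank = p := by
  classical
  obtain ⟨l, G, hGu, hGG, hpow, hct⟩ := exists_atoms t S hSsym hM hH
  let U : (y : ℝ) → Matrix {k // l k = y} (Fin p) ℝ := fun y k a => G k.1 (0, a)
  have hUa : ∀ y k a, U y k a = G k.1 (0, a) := fun _ _ _ => rfl
  clear_value U
  let W : ℝ → Matrix (Fin p) (Fin p) ℝ := fun y => (U y)ᵀ * U y
  have hli : ∀ y, LinearIndependent ℝ (U y).row := by
    intro y
    have hrows := Matrix.linearIndependent_rows_iff_isUnit.2 hGu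
    have hrows' := hrows.comp (fun k : {k // l k = y} => k.1) Subtype.val_injective
    rw [Fintype.linearIndependent_iff] at hrows' ⊢
    intro g hg
    apply hrows'
    funext i
    have := congrFun hg i.2
    simp only [Finset.sum_apply, Pi.smul_apply, smul_eq_mul, Pi.zero_apply, Function.comp, hUa,
      Matrix.row] at this ⊢
    rw [← mul_zero (y ^ (i.1 : ℕ)), ← this, Finset.mul_sum]
    refine Finset.sum_congr rfl fun k _ => ?_
    rw [hpow k.1 i, k.2]; ring
  have hrank : ∀ y, (W y).rank = Fintype.card {k // l k = y} := by
    intro y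
    rw [Matrix.rank_transpose_mul_self]
    exact (hli y).rank_matrix
  let E := Finset.univ.image l
  let e := E.equivFin
  have hsum : ∀ f : ℝ → ℝ, ∑ j, f (e.symm j : ℝ) = ∑ y ∈ E, f y := by
    intro f
    rw [e.symm.sum_comp (fun y : E => f y), Finset.sum_coe_sort E f]
  have hmem : ∀ k, l k ∈ E := fun k => Finset.mem_image_of_mem l (Finset.mem_univ k)
  have hcardpos : ∀ y ∈ E, 0 < Fintype.card {k // l k = y} := by
    intro y hy
    obtain ⟨k, _, hk⟩ := Finset.mem_image.1 hy
    exact Fintype.card_pos_iff.2 ⟨⟨k, hk⟩⟩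
  refine ⟨E.card, fun j => (e.symm j : ℝ), fun j => W (e.symm j), ⟨?_, ?_, ?_, ?_⟩, ?_⟩
  · exact Subtype.val_injective.comp e.symm.injective
  · intro j
    refine ⟨?_, ?_⟩
    · intro h0
      have h1 := hrank (e.symm j)
      beta_reduce at h0
      rw [h0, Matrix.rank_zero] at h1
      have := hcardpos _ (e.symm j).2
      omega
    · have := Matrix.posSemidef_conjTranspose_mul_self (U (e.symm j))
      rwa [conjTranspose_eq_transpose_of_trivial] at this
  · intro i hi
    ext a b
    rw [Matrix.sum_apply]
    simp only [Matrix.smul_apply, smul_eq_mul]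
    rw [hsum (fun y => y ^ i * W y a b)]
    have hSi : S i a b = ∑ k, l k ^ i * (G k (0, a) * G k (0, b)) := by
      obtain ⟨i1, i2, hi1, hi2, rfl⟩ : ∃ i1 i2, i1 < n + 1 ∧ i2 < n + 1 ∧ i1 + i2 = i :=
        ⟨min i n, i - min i n, by omega, by omega, by omega⟩
      have := congrFun (congrFun hGG (⟨i1, hi1⟩, a)) (⟨i2, hi2⟩, b)
      rw [Matrix.mul_apply] at this
      simp only [momentMatrix] at this
      rw [← this]
      refine Finset.sum_congr rfl fun k _ => ?_
      rw [transpose_apply, hpow k (⟨i1, hi1⟩, a), hpow k (⟨i2, hi2⟩, b)]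
      simp only [pow_add]; ring
    rw [hSi, ← Finset.sum_fiberwise_of_maps_to (s := Finset.univ) (t := E) (g := l) (fun k _ => hmem k)]
    refine Finset.sum_congr rfl fun y _ => ?_
    have hW : W y a b = ∑ k : {k // l k = y}, G k.1 (0, a) * G k.1 (0, b) := by
      simp only [W, Matrix.mul_apply, transpose_apply, hUa]
    rw [hW]
    rw [Finset.mul_sum, Finset.sum_subtype (p := fun k => l k = y) _ (by simp)]
    refine Finset.sum_congr rfl fun k _ => ?_
    rw [k.2]
  · simp only [hrank]
    have h1 : ∑ j, Fintype.card {k // l k = (e.symm j : ℝ)} = ∑ y ∈ E, Fintype.card {k // l k = y} := by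
      rw [e.symm.sum_comp (fun y : E => Fintype.card {k // l k = (y : ℝ)}),
        Finset.sum_coe_sort E (fun y => Fintype.card {k // l k = y})]
    rw [h1]
    have h2 := Finset.card_eq_sum_card_fiberwise (s := Finset.univ) (t := E) (f := l)
      (fun k _ => hmem k)
    simp only [Fintype.card_subtype]
    rw [← h2]; simp
  · have htE : t ∈ E := by
      have : 0 < Fintype.card {k // l k = t} := by omega
      obtain ⟨k, hk⟩ := Fintype.card_pos_iff.1 this
      rw [← hk]; exact hmem k
    refine ⟨e ⟨t, htE⟩, by simp, ?_⟩
    rw [hrank]; simp [hct]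

/-- Remark 3.2(4): if `M(n) ≻ 0` and the localizing matrix `H_{x-t}(n-1)` is invertible
(rank `np`), then there exists a minimal representing measure for `S` with multiplicity `p`
at `t`, and such a measure is unique: any two of them assign the same mass to every point
`s ∈ ℝ`. -/
theorem unique_measure_with_full_multiplicity (p n : ℕ) (hp : 1 ≤ p) (hn : 1 ≤ n)
    (S : ℕ → Matrix (Fin p) (Fin p) ℝ)
    (hSsym : ∀ i ≤ 2 * n, (S i).IsSymm)
    (hM : (momentMatrix p n S).PosDef)
    (t : ℝ)
    (hH : (locMatrix p n t S).rank = n * p) :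
    (∃ (ℓ : ℕ) (x : Fin ℓ → ℝ) (A : Fin ℓ → Matrix (Fin p) (Fin p) ℝ),
        IsMinimalRepMeasure p n ℓ S x A ∧ ∃ j, x j = t ∧ (A j).rank = p) ∧
      (∀ (ℓ₁ : ℕ) (x₁ : Fin ℓ₁ → ℝ) (A₁ : Fin ℓ₁ → Matrix (Fin p) (Fin p) ℝ),
        IsMinimalRepMeasure p n ℓ₁ S x₁ A₁ → (∃ j, x₁ j = t ∧ (A₁ j).rank = p) →
        ∀ (ℓ₂ : ℕ) (x₂ : Fin ℓ₂ → ℝ) (A₂ : Fin ℓ₂ → Matrix (Fin p) (Fin p) ℝ),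
        IsMinimalRepMeasure p n ℓ₂ S x₂ A₂ → (∃ j, x₂ j = t ∧ (A₂ j).rank = p) →
        ∀ s : ℝ,
          (∑ j ∈ Finset.univ.filter (fun j => x₁ j = s), A₁ j) =
            ∑ j ∈ Finset.univ.filter (fun j => x₂ j = s), A₂ j) := by

  refine ⟨exists_measure hp t S hSsym hM hH, ?_⟩
  intro ℓ₁ x₁ A₁ h₁ ht₁ ℓ₂ x₂ A₂ h₂ ht₂ s
  ext a b
  rw [Matrix.sum_apply, Matrix.sum_apply]
  refine mass_of_moments t x₁ x₂ (fun j => A₁ j a b) (fun j => A₂ j a b) (fun m => ?_) s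
  rw [measure_moments t S hH x₁ A₁ h₁ ht₁ m a b, measure_moments t S hH x₂ A₂ h₂ ht₂ m a b]
end
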